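/- arXiv:1006.1226 — 2 statements merged into one kernel-verified Lean document; each statement's English description precedes it below -/
import Mathlib

section
/- For every positive integer n and every k ≥ 0, the number of isomorphism classes of partial orders P on a set of n elements such that P contains no four (distinct) elements a, b, c, d with a < b and c < d and with each of a, b incomparable to each of c, d (i.e., P is (2+2)-free), and such that P has exactly k minimal elements, equals the coefficient of z^k t^n in the polynomial Σ_{m=0}^{n} ∏_{i=1}^{m} ( 1 − (1−t)^{i−1}(1−zt) ) in the variables t and z. -/
open Polynomial

/-- Two partial orders on `Fin n` are isomorphic. -/
def OrderIsoRel (n : ℕ) (P Q : PartialOrder (Fin n)) : Prop :=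
  ∃ e : Fin n ≃ Fin n, ∀ a b : Fin n, P.le a b ↔ Q.le (e a) (e b)

/-- A partial order on `Fin n` is `(2+2)`-free: there are no elements `a, b, c, d` with
`a < b` and `c < d` such that each of `a, b` is incomparable to each of `c, d`. -/
def TwoTwoFree (n : ℕ) (P : PartialOrder (Fin n)) : Prop :=
  ¬ ∃ a b c d : Fin n, P.lt a b ∧ P.lt c d ∧
      (¬ P.le a c ∧ ¬ P.le c a) ∧ (¬ P.le a d ∧ ¬ P.le d a) ∧
      (¬ P.le b c ∧ ¬ P.le c b) ∧ (¬ P.le b d ∧ ¬ P.le d b)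

/-- The number of minimal elements of a partial order on `Fin n`. -/
noncomputable def minCount (n : ℕ) (P : PartialOrder (Fin n)) : ℕ :=
  {x : Fin n | ∀ y : Fin n, ¬ P.lt y x}.ncard

namespace Fishburn
open Finset

/-- Endpoint functions of a family of nonempty intervals in `{0, …, m - 1}` in which every point
is a left endpoint and a right endpoint. -/
structure IsMinimalRep {α : Type*} (m : ℕ) (l r : α → ℕ) : Prop where
  le : ∀ x, l x ≤ r x
  lt : ∀ x, r x < m
  exists_left : ∀ j < m, ∃ x, l x = j
  exists_right : ∀ j < m, ∃ x, r x = j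

namespace IsMinimalRep

variable {α : Type*} {m m' : ℕ} {l r l' r' : α → ℕ}

theorem left_lt (h : IsMinimalRep m l r) (x : α) : l x < m := (h.le x).trans_lt (h.lt x)

theorem comp_equiv {β : Type*} (h : IsMinimalRep m l r) (e : β ≃ α) :
    IsMinimalRep m (l ∘ e) (r ∘ e) where
  le x := h.le _
  lt x := h.lt _
  exists_left j hj := (h.exists_left j hj).imp' e.symm fun x hx => by simpa using hx
  exists_right j hj := (h.exists_right j hj).imp' e.symm fun x hx => by simpa using hx

theorem left_le (h : IsMinimalRep m l r) (h' : ∀ x y, r x < l y → r' x < l' y)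
    (h'' : ∀ x y, r' x < l' y → r x < l y) (x : α) : l x ≤ l' x := by
  obtain ⟨j, hj⟩ : ∃ j, l x = j := ⟨_, rfl⟩
  induction j generalizing x with
  | zero => omega
  | succ j ih =>
    have hm := h.left_lt x
    obtain ⟨y, hy⟩ := h.exists_right j (by omega)
    have := h' y x (by omega)
    obtain ⟨z, hz⟩ := h.exists_left j (by omega)
    have h1 := ih z hz
    have h2 := mt (h'' y z) (by omega)
    omega

theorem left_eq (h : IsMinimalRep m l r) (h' : IsMinimalRep m' l' r')
    (hlt : ∀ x y, r x < l y ↔ r' x < l' y) (x : α) : l x = l' x :=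
  le_antisymm (h.left_le (fun x y => (hlt x y).1) (fun x y => (hlt x y).2) x)
    (h'.left_le (fun x y => (hlt x y).2) (fun x y => (hlt x y).1) x)

theorem right_le (h : IsMinimalRep m l r) (h' : IsMinimalRep m' l' r')
    (hlt : ∀ x y, r x < l y ↔ r' x < l' y) (x : α) : r x ≤ r' x := by
  obtain ⟨z, hz⟩ := h.exists_left (r x) (h.lt x)
  have h1 := h.left_eq h' hlt z
  have h2 := mt (hlt x z).2 (by omega)
  omega

theorem right_eq (h : IsMinimalRep m l r) (h' : IsMinimalRep m' l' r')
    (hlt : ∀ x y, r x < l y ↔ r' x < l' y) (x : α) : r x = r' x :=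
  le_antisymm (h.right_le h' hlt x) (h'.right_le h (fun x y => (hlt x y).symm) x)

theorem size_le (h : IsMinimalRep m l r) (h' : IsMinimalRep m' l' r')
    (hlt : ∀ x y, r x < l y ↔ r' x < l' y) : m ≤ m' := by
  by_contra! hm
  obtain ⟨x, hx⟩ := h.exists_left m' hm
  have h1 := h.left_eq h' hlt x
  have h2 := h'.left_lt x
  omega

theorem size_eq (h : IsMinimalRep m l r) (h' : IsMinimalRep m' l' r')
    (hlt : ∀ x y, r x < l y ↔ r' x < l' y) : m = m' :=
  le_antisymm (h.size_le h' hlt) (h'.size_le h fun x y => (hlt x y).symm)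

/-- The interval order of a family of nonempty intervals. -/
@[reducible] def toPartialOrder (h : IsMinimalRep m l r) : PartialOrder α where
  le x y := x = y ∨ r x < l y
  lt x y := r x < l y
  le_refl x := Or.inl rfl
  le_trans x y z := by
    rintro (rfl | h1) (rfl | h2)
    · exact Or.inl rfl
    · exact Or.inr h2
    · exact Or.inr h1
    · have := h.le y
      exact Or.inr (by omega)
  le_antisymm x y := by
    rintro (rfl | h1) (h2 | h2)
    · rfl
    · rfl
    · exact h2.symm
    · have := h.le x
      have := h.le y
      omega
  lt_iff_le_not_ge x y := by
    have := h.le x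
    have := h.le y
    constructor
    · intro h1
      refine ⟨Or.inr h1, ?_⟩
      rintro (rfl | h2) <;> omega
    · rintro ⟨rfl | h1, h2⟩
      · exact absurd (Or.inl rfl) h2
      · exact h1

end IsMinimalRep

/-- The strict down-sets of a poset without induced `2 + 2` form a chain, and hence the poset is
the interval order of a minimal family of intervals. -/
theorem exists_isMinimalRep {α : Type*} [PartialOrder α] [Fintype α]
    (hfree : ¬ ∃ a b c d : α, a < b ∧ c < d ∧ (¬ a ≤ c ∧ ¬ c ≤ a) ∧ (¬ a ≤ d ∧ ¬ d ≤ a) ∧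
      (¬ b ≤ c ∧ ¬ c ≤ b) ∧ (¬ b ≤ d ∧ ¬ d ≤ b)) :
    ∃ (m : ℕ) (l r : α → ℕ), m ≤ Fintype.card α ∧ IsMinimalRep m l r ∧
      ∀ x y, x < y ↔ r x < l y := by
  classical
  let D : α → Finset α := fun x => {y | y < x}
  have hD : ∀ {x y}, x ∈ D y ↔ x < y := by simp [D]
  have hchain : ∀ x y, D x ⊆ D y ∨ D y ⊆ D x := by
    intro x y
    by_contra! h
    obtain ⟨⟨a, hax, hay⟩, ⟨c, hcy, hcx⟩⟩ := And.imp not_subset.1 not_subset.1 h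
    rw [hD] at hax hay hcy hcx
    refine hfree ⟨a, x, c, y, hax, hcy, ⟨fun h => hay (h.trans_lt hcy),
      fun h => hcx (h.trans_lt hax)⟩, ⟨fun h => ?_, fun h => hcx (hcy.trans_le (h.trans hax.le))⟩,
      ⟨fun h => hay (hax.trans_le (h.trans hcy.le)), fun h => ?_⟩,
      ⟨fun h => hay (hax.trans_le h), fun h => hcx (hcy.trans_le h)⟩⟩
    · rcases h.lt_or_eq with h | rfl
      exacts [hay h, hcx (hcy.trans hax)]
    · rcases h.lt_or_eq with h | rfl
      exacts [hcx h, hay (hax.trans hcy)]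
  let 𝒟 : Finset (Finset α) := univ.image D
  have h𝒟 : ∀ x, D x ∈ 𝒟 := fun x => mem_image_of_mem D (mem_univ x)
  have h𝒟' : ∀ {S}, S ∈ 𝒟 → ∃ x, D x = S := fun h => by simpa [𝒟] using h
  let rank : Finset α → ℕ := fun S => #{T ∈ 𝒟 | T ⊂ S}
  let l : α → ℕ := fun x => rank (D x)
  let r : α → ℕ := fun x => #{T ∈ 𝒟 | x ∉ T} - 1
  have hpos : ∀ x, 0 < #{T ∈ 𝒟 | x ∉ T} := fun x =>
    card_pos.2 ⟨D x, mem_filter.2 ⟨h𝒟 x, by simp [hD]⟩⟩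
  have hlt : ∀ x y, x < y ↔ r x < l y := by
    intro x y
    constructor
    · intro hxy
      have : #{T ∈ 𝒟 | x ∉ T} ≤ l y := by
        refine card_le_card fun T hT => ?_
        rw [mem_filter] at hT ⊢
        obtain ⟨z, rfl⟩ := h𝒟' hT.1
        refine ⟨hT.1, ?_⟩
        have hnot : ¬ D y ⊆ D z := fun h => hT.2 (h (hD.2 hxy))
        exact ⟨(hchain z y).resolve_right hnot, hnot⟩
      have := hpos x
      show _ - 1 < _
      omega
    · intro h
      by_contra hxy
      have : l y < #{T ∈ 𝒟 | x ∉ T} := by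
        refine card_lt_card ⟨fun T hT => ?_, fun hsub => ?_⟩
        · rw [mem_filter] at hT ⊢
          exact ⟨hT.1, fun hx => hxy (hD.1 (hT.2.1 hx))⟩
        · have := hsub (mem_filter.2 ⟨h𝒟 y, fun hx => hxy (hD.1 hx)⟩)
          exact (mem_filter.1 this).2.2 subset_rfl
      have h' : #{T ∈ 𝒟 | x ∉ T} - 1 < l y := h
      omega
  have hrank_lt : ∀ {S T}, S ∈ 𝒟 → S ⊂ T → rank S < rank T := by
    intro S T hS hST
    refine card_lt_card ⟨fun U hU => ?_, fun hsub => ?_⟩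
    · rw [mem_filter] at hU ⊢
      exact ⟨hU.1, hU.2.trans hST⟩
    · exact (mem_filter.1 (hsub (mem_filter.2 ⟨hS, hST⟩))).2.2 subset_rfl
  have hrank_card : ∀ {S}, S ∈ 𝒟 → rank S < #𝒟 := fun {S} hS =>
    card_lt_card ⟨filter_subset _ _, fun hsub => (mem_filter.1 (hsub hS)).2.2 subset_rfl⟩
  have hinj : Set.InjOn rank 𝒟 := by
    intro S hS T hT hST
    obtain ⟨x, rfl⟩ := h𝒟' hS
    obtain ⟨y, rfl⟩ := h𝒟' hT
    by_contra hne
    rcases hchain x y with h | h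
    · exact (hrank_lt hS (h.ssubset_of_ne hne)).ne hST
    · exact (hrank_lt hT (h.ssubset_of_ne (Ne.symm hne))).ne' hST
  have hleft : ∀ j < #𝒟, ∃ x, l x = j := by
    intro j hj
    obtain ⟨S, hS, rfl⟩ := surjOn_of_injOn_of_card_le (t := range #𝒟) rank
      (fun S hS => by simpa using hrank_card hS) hinj (by simp) (by simpa using hj)
    obtain ⟨x, rfl⟩ := h𝒟' hS
    exact ⟨x, rfl⟩
  have hr : ∀ x, r x < #𝒟 := fun x => by
    have h1 := hpos x
    have h2 : #{T ∈ 𝒟 | x ∉ T} ≤ #𝒟 := card_filter_le _ _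
    show _ - 1 < _
    omega
  refine ⟨#𝒟, l, r, card_image_le, ⟨fun x => ?_, hr, hleft, fun j hj => ?_⟩, hlt⟩
  · exact not_lt.1 (mt (hlt x x).2 (lt_irrefl x))
  · obtain ⟨z, hz⟩ := hleft j hj
    by_cases hj' : j + 1 < #𝒟
    · obtain ⟨y, hy⟩ := hleft (j + 1) hj'
      have hns : ¬ D y ⊆ D z := fun h => by
        rcases h.eq_or_ssubset with h | h
        · have : l y = l z := congrArg rank h
          omega
        · have : l y < l z := hrank_lt (h𝒟 y) h
          omega
      obtain ⟨x, hxy, hxz⟩ := not_subset.1 hns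
      have h1 := (hlt x y).1 (hD.1 hxy)
      have h2 := mt (hlt x z).2 (fun h => hxz (hD.2 h))
      exact ⟨x, by omega⟩
    · refine ⟨z, ?_⟩
      have h1 := hr z
      have h2 := mt (hlt z z).2 (lt_irrefl z)
      omega

/-- The matrix `A` counts the intervals of a minimal representation of `P`. -/
def Represents {n m : ℕ} (A : Fin m → Fin m → ℕ) (P : PartialOrder (Fin n)) : Prop :=
  ∃ l r : Fin n → ℕ, IsMinimalRep m l r ∧ (∀ x y, P.lt x y ↔ r x < l y) ∧
    ∀ i j : Fin m, A i j = #{x | r x = i ∧ l x = j}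

/-- Lower triangular matrices of natural numbers without zero rows or columns. -/
def IsFishburn {m : ℕ} (A : Fin m → Fin m → ℕ) : Prop :=
  (∀ i j, i < j → A i j = 0) ∧ (∀ i, A i ≠ 0) ∧ ∀ j, ∃ i, A i j ≠ 0

/-- The sum of the entries in the first column. -/
def firstColumnSum {m : ℕ} (A : Fin m → Fin m → ℕ) : ℕ :=
  ∑ i, ∑ j : Fin m, if (j : ℕ) = 0 then A i j else 0

theorem lt_iff_of_le_iff {α β : Type*} {P : PartialOrder α} {Q : PartialOrder β} {e : α → β}
    (h : ∀ a b, P.le a b ↔ Q.le (e a) (e b)) (a b : α) : P.lt a b ↔ Q.lt (e a) (e b) := by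
  rw [P.lt_iff_le_not_ge, Q.lt_iff_le_not_ge, h, h]

theorem le_iff_of_lt_iff {α β : Type*} {P : PartialOrder α} {Q : PartialOrder β} {e : α ≃ β}
    (h : ∀ a b, P.lt a b ↔ Q.lt (e a) (e b)) (a b : α) : P.le a b ↔ Q.le (e a) (e b) := by
  have h1 : P.le a b ↔ P.lt a b ∨ a = b := @le_iff_lt_or_eq α P a b
  have h2 : Q.le (e a) (e b) ↔ Q.lt (e a) (e b) ∨ e a = e b :=
    @le_iff_lt_or_eq β Q (e a) (e b)
  rw [h1, h2, h, e.apply_eq_iff_eq]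

theorem equivalence_orderIsoRel (n : ℕ) : Equivalence (OrderIsoRel n) where
  refl P := ⟨Equiv.refl _, fun a b => Iff.rfl⟩
  symm := fun ⟨e, he⟩ => ⟨e.symm, fun a b => by simp [he]⟩
  trans := fun ⟨e, he⟩ ⟨f, hf⟩ => ⟨e.trans f, fun a b => by simp [he, hf]⟩

theorem quot_mk_eq_iff {n : ℕ} {P Q : PartialOrder (Fin n)} :
    Quot.mk (OrderIsoRel n) P = Quot.mk (OrderIsoRel n) Q ↔ OrderIsoRel n P Q :=
  ⟨fun h => (equivalence_orderIsoRel n).eqvGen_iff.1 (Quot.eqvGen_exact h), Quot.sound⟩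

theorem Represents.twoTwoFree {n m : ℕ} {A : Fin m → Fin m → ℕ} {P : PartialOrder (Fin n)}
    (h : Represents A P) : TwoTwoFree n P := by
  obtain ⟨l, r, -, hlt, -⟩ := h
  rintro ⟨a, b, c, d, hab, hcd, -, ⟨had, -⟩, ⟨-, hcb⟩, -⟩
  have h1 := (hlt _ _).1 hab
  have h2 := (hlt _ _).1 hcd
  rcases le_total (l b) (l d) with h | h
  · exact had (@le_of_lt _ P.toPreorder _ _ ((hlt a d).2 (h1.trans_le h)))
  · exact hcb (@le_of_lt _ P.toPreorder _ _ ((hlt c b).2 (h2.trans_le h)))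

theorem Represents.isFishburn {n m : ℕ} {A : Fin m → Fin m → ℕ} {P : PartialOrder (Fin n)}
    (h : Represents A P) : IsFishburn A := by
  obtain ⟨l, r, hrep, -, hA⟩ := h
  refine ⟨fun i j hij => ?_, fun i h0 => ?_, fun j => ?_⟩
  · rw [hA, card_eq_zero, filter_eq_empty_iff]
    rintro x - ⟨h1, h2⟩
    have := hrep.le x
    have : (i : ℕ) < j := hij
    omega
  · obtain ⟨x, hx⟩ := hrep.exists_right i i.2
    have h1 := hA i ⟨l x, hrep.left_lt x⟩
    rw [h0, Pi.zero_apply, eq_comm, card_eq_zero, filter_eq_empty_iff] at h1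
    exact h1 (mem_univ x) ⟨hx, rfl⟩
  · obtain ⟨x, hx⟩ := hrep.exists_left j j.2
    refine ⟨⟨r x, hrep.lt x⟩, fun h0 => ?_⟩
    rw [hA, card_eq_zero, filter_eq_empty_iff] at h0
    exact h0 (mem_univ x) ⟨rfl, hx⟩

theorem card_eq_sum_card_left_right {n m : ℕ} {l r : Fin n → ℕ} (h : IsMinimalRep m l r)
    (p : Fin n → Prop) [DecidablePred p] :
    #{x | p x} = ∑ i : Fin m, ∑ j : Fin m, #{x | p x ∧ r x = i ∧ l x = j} := by
  rw [← Fintype.sum_prod_type' (f := fun i j : Fin m => #{x | p x ∧ r x = i ∧ l x = j}),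
    card_eq_sum_card_fiberwise (f := fun x => ((⟨r x, h.lt x⟩, ⟨l x, h.left_lt x⟩) : Fin m × Fin m))
      (t := univ) (by simp)]
  refine sum_congr rfl fun q _ => ?_
  rw [filter_filter]
  congr 1
  ext x
  simp [Prod.ext_iff, Fin.ext_iff]

theorem Represents.sum_eq {n m : ℕ} {A : Fin m → Fin m → ℕ} {P : PartialOrder (Fin n)}
    (h : Represents A P) : ∑ i, ∑ j, A i j = n := by
  obtain ⟨l, r, hrep, -, hA⟩ := h
  have := card_eq_sum_card_left_right hrep (fun _ => True)
  simp only [filter_true, card_univ, Fintype.card_fin, true_and] at this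
  simp_rw [hA]
  exact this.symm

theorem Represents.minCount_eq {n m : ℕ} {A : Fin m → Fin m → ℕ} {P : PartialOrder (Fin n)}
    (h : Represents A P) : minCount n P = firstColumnSum A := by
  obtain ⟨l, r, hrep, hlt, hA⟩ := h
  have hmin : ∀ x, (∀ y, ¬ P.lt y x) ↔ l x = 0 := by
    intro x
    simp_rw [hlt]
    constructor
    · intro h
      by_contra h0
      obtain ⟨y, hy⟩ := hrep.exists_right 0 ((Nat.zero_le _).trans_lt (hrep.lt x))
      exact h y (by omega)
    · intro h y
      omega
  rw [minCount, firstColumnSum]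
  simp_rw [hmin]
  rw [Set.ncard_eq_toFinset_card', Set.toFinset_ofPred, card_eq_sum_card_left_right hrep]
  refine sum_congr rfl fun i _ => sum_congr rfl fun j _ => ?_
  split_ifs with hj
  · rw [hA]
    congr 1
    ext x
    simp [hj]
  · rw [card_eq_zero, filter_eq_empty_iff]
    rintro x - ⟨h1, -, h2⟩
    omega

theorem exists_represents {n : ℕ} {P : PartialOrder (Fin n)} (h : TwoTwoFree n P) :
    ∃ m ≤ n, ∃ A : Fin m → Fin m → ℕ, Represents A P := by
  obtain ⟨m, l, r, hm, hrep, hlt⟩ := @exists_isMinimalRep (Fin n) P _ h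
  exact ⟨m, by simpa using hm, fun i j => #{x | r x = i ∧ l x = j}, l, r, hrep, hlt,
    fun _ _ => rfl⟩

theorem exists_represented {n m : ℕ} {A : Fin m → Fin m → ℕ} (hA : IsFishburn A)
    (hn : ∑ i, ∑ j, A i j = n) : ∃ P : PartialOrder (Fin n), Represents A P := by
  have hcard : Fintype.card (Fin n) = Fintype.card (Σ p : Fin m × Fin m, Fin (A p.1 p.2)) := by
    simp [← hn, Fintype.sum_prod_type]
  obtain ⟨e⟩ := Fintype.card_eq.1 hcard
  have hcount : ∀ i j : Fin m, A i j = #{x | (e x).1.1 = i ∧ (e x).1.2 = j} := by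
    intro i j
    rw [← Fintype.card_subtype, ← Fintype.card_fin (A i j)]
    refine Fintype.card_congr ((Equiv.sigmaSubtype (α := Fin m × Fin m)
      (β := fun p => Fin (A p.1 p.2)) (i, j)).symm.trans
      ((e.subtypeEquiv fun x => ?_).symm))
    simp [Prod.ext_iff]
  have hne : ∀ i j : Fin m, A i j ≠ 0 → ∃ x, (e x).1.1 = i ∧ (e x).1.2 = j := by
    intro i j h
    rw [hcount, ← Nat.pos_iff_ne_zero, card_pos] at h
    obtain ⟨x, hx⟩ := h
    exact ⟨x, (mem_filter.1 hx).2⟩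
  have hrep : IsMinimalRep m (fun x => ((e x).1.2 : ℕ)) (fun x => ((e x).1.1 : ℕ)) := by
    refine ⟨fun x => ?_, fun x => (e x).1.1.2, fun j hj => ?_, fun j hj => ?_⟩
    · by_contra! h
      have h0 := hA.1 _ _ (Fin.lt_def.2 h)
      exact (Fin.cast h0 (e x).2).elim0
    · obtain ⟨i, hi⟩ := hA.2.2 ⟨j, hj⟩
      obtain ⟨x, -, hx⟩ := hne _ _ hi
      exact ⟨x, by simp [hx]⟩
    · obtain ⟨i, hi⟩ := Function.ne_iff.1 (hA.2.1 ⟨j, hj⟩)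
      obtain ⟨x, hx, -⟩ := hne _ _ hi
      exact ⟨x, by simp [hx]⟩
  refine ⟨hrep.toPartialOrder, _, _, hrep, fun _ _ => Iff.rfl, fun i j => ?_⟩
  simp_rw [hcount i j, Fin.ext_iff]

theorem Represents.orderIsoRel {n m : ℕ} {A : Fin m → Fin m → ℕ} {P Q : PartialOrder (Fin n)}
    (hP : Represents A P) (hQ : Represents A Q) : OrderIsoRel n P Q := by
  obtain ⟨l, r, hrep, hlt, hA⟩ := hP
  obtain ⟨l', r', hrep', hlt', hA'⟩ := hQ
  let f : Fin n → Fin m × Fin m := fun x => (⟨r x, hrep.lt x⟩, ⟨l x, hrep.left_lt x⟩)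
  let f' : Fin n → Fin m × Fin m := fun x => (⟨r' x, hrep'.lt x⟩, ⟨l' x, hrep'.left_lt x⟩)
  have hcard : ∀ q, Fintype.card {x // f x = q} = Fintype.card {x // f' x = q} := by
    rintro ⟨i, j⟩
    simpa [Fintype.card_subtype, f, f', Prod.ext_iff, Fin.ext_iff] using
      (hA i j).symm.trans (hA' i j)
  let e : Fin n ≃ Fin n := Equiv.ofFiberEquiv (f := f) (g := f')
    fun q => Classical.choice (Fintype.card_eq.1 (hcard q))
  have he : ∀ x, f' (e x) = f x := fun x => Equiv.ofFiberEquiv_map _ x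
  refine ⟨e, le_iff_of_lt_iff fun a b => ?_⟩
  have h1 : r' (e a) = r a := congrArg (fun q : Fin m × Fin m => (q.1 : ℕ)) (he a)
  have h2 : l' (e b) = l b := congrArg (fun q : Fin m × Fin m => (q.2 : ℕ)) (he b)
  rw [hlt, hlt', h1, h2]

theorem Represents.sigma_eq {n m m' : ℕ} {A : Fin m → Fin m → ℕ} {A' : Fin m' → Fin m' → ℕ}
    {P Q : PartialOrder (Fin n)} (hP : Represents A P) (hQ : Represents A' Q)
    (hPQ : OrderIsoRel n P Q) :
    (⟨m, A⟩ : Σ m, Fin m → Fin m → ℕ) = ⟨m', A'⟩ := by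
  obtain ⟨l, r, hrep, hlt, hA⟩ := hP
  obtain ⟨l', r', hrep', hlt', hA'⟩ := hQ
  obtain ⟨e, he⟩ := hPQ
  have hcomp := hrep'.comp_equiv e
  have h : ∀ x y, r x < l y ↔ (r' ∘ e) x < (l' ∘ e) y := fun x y => by
    rw [← hlt, lt_iff_of_le_iff he, hlt', Function.comp_apply, Function.comp_apply]
  obtain rfl := hrep.size_eq hcomp h
  congr 1
  funext i j
  rw [hA, hA']
  refine card_equiv e fun x => ?_
  have h1 := hrep.left_eq hcomp h x
  have h2 := hrep.right_eq hcomp h x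
  simp only [Function.comp_apply] at h1 h2
  simp [h1, h2]

/-- Isomorphism classes of `(2+2)`-free posets correspond to Fishburn matrices, and minimal
elements are counted by the first column. -/
theorem ncard_isoClasses (n k : ℕ) (M : (m : ℕ) → Finset (Fin m → Fin m → ℕ))
    (hM : ∀ m A, A ∈ M m ↔ IsFishburn A ∧ ∑ i, ∑ j, A i j = n ∧ firstColumnSum A = k) :
    (Quot.mk (OrderIsoRel n) ''
        {P : PartialOrder (Fin n) | TwoTwoFree n P ∧ minCount n P = k}).ncard
      = ∑ m ∈ range (n + 1), #(M m) := by
  rw [← card_sigma, ← Set.ncard_coe_finset]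
  symm
  have hex : ∀ B ∈ ((range (n + 1)).sigma M : Finset (Σ m, Fin m → Fin m → ℕ)),
      ∃ P : PartialOrder (Fin n), Represents B.2 P := fun B hB => by
    have h := (hM _ _).1 (mem_sigma.1 hB).2
    exact exists_represented h.1 h.2.1
  choose P hP using hex
  refine Set.ncard_congr (fun B hB => Quot.mk _ (P B hB)) (fun B hB => ?_) ?_ ?_
  · have h := (hM _ _).1 (mem_sigma.1 (mem_coe.1 hB)).2
    exact ⟨_, ⟨(hP B hB).twoTwoFree, (hP B hB).minCount_eq.trans h.2.2⟩, rfl⟩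
  · intro B B' hB hB' h
    exact (hP B hB).sigma_eq (hP B' hB') (quot_mk_eq_iff.1 h)
  · rintro _ ⟨Q, ⟨hQ, rfl⟩, rfl⟩
    obtain ⟨m, hm, A, hA⟩ := exists_represents hQ
    have hmem : (⟨m, A⟩ : Σ m, Fin m → Fin m → ℕ) ∈ (range (n + 1)).sigma M :=
      mem_sigma.2 ⟨mem_range.2 (Nat.lt_succ_of_le hm),
        (hM _ _).2 ⟨hA.isFishburn, hA.sum_eq, hA.minCount_eq.symm⟩⟩
    exact ⟨⟨m, A⟩, hmem, quot_mk_eq_iff.2 ((hP _ hmem).orderIsoRel hA)⟩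


/-- The signed transfer operator that adds one row and one column to a triangular matrix, with
row weights `c`; the argument counts the columns that are not forced to vanish. -/
def transfer {R : Type*} [CommRing R] (c : ℕ → R) (φ : ℕ → R) (j : ℕ) : R :=
  c (j + 1) * φ (j + 1) - c j * φ j

theorem pow_dvd_transfer_iterate {R : Type*} [CommRing R] {c : ℕ → R} {t : R}
    (hc : ∀ j, t ∣ c j) (φ : ℕ → R) (m j : ℕ) : t ^ m ∣ (transfer c)^[m] φ j := by
  induction m generalizing j with
  | zero => simp
  | succ m ih =>
    rw [Function.iterate_succ_apply', pow_succ']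
    exact dvd_sub (mul_dvd_mul (hc _) (ih _)) (mul_dvd_mul (hc _) (ih _))

theorem transfer_sub {R : Type*} [CommRing R] (c φ ψ : ℕ → R) :
    transfer c (φ - ψ) = transfer c φ - transfer c ψ := by
  ext j
  simp only [transfer, Pi.sub_apply]
  ring

theorem sum_transfer_iterate_sub {R : Type*} [CommRing R] (c ψ : ℕ → R) (N : ℕ) :
    ∑ m ∈ range N, (transfer c)^[m] (ψ - transfer c ψ) = ψ - (transfer c)^[N] ψ := by
  induction N with
  | zero => simp
  | succ N ih =>
    have h : ∀ φ χ : ℕ → R, (transfer c)^[N] (φ - χ)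
        = (transfer c)^[N] φ - (transfer c)^[N] χ := by
      intro φ χ
      clear ih
      induction N generalizing φ χ with
      | zero => rfl
      | succ N ih => simp only [Function.iterate_succ_apply, transfer_sub, ih]
    rw [sum_range_succ, ih, h, ← Function.iterate_succ_apply, sub_add_sub_cancel]

/-- The Neumann series of the transfer operator, evaluated on the constant function `1`. -/
theorem sum_transfer_iterate_one {R : Type*} [CommRing R] {c u : ℕ → R} {t : R} {N : ℕ}
    (hN : t ^ N = 0) (hc : ∀ j, t ∣ c j) (hu : ∀ j, u j * (1 + c j) = 1) (hu0 : u 0 = 1) :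
    ∑ m ∈ range N, (transfer c)^[m] 1 0
      = ∑ m ∈ range N, ∏ i ∈ range m, (1 - u (i + 1)) := by
  set ψ : ℕ → R := fun j => u j * ∑ m ∈ range N, ∏ i ∈ range m, (1 - u (j + 1 + i)) with hψ
  have hcu : ∀ j, c j * u j = 1 - u j := fun j => by linear_combination hu j
  have hψ1 : ψ - transfer c ψ = 1 := by
    ext j
    have hprod : ∏ i ∈ range N, (1 - u (j + 1 + i)) = 0 := by
      have : t ^ N ∣ ∏ i ∈ range N, (1 - u (j + 1 + i)) := by
        have := Finset.prod_dvd_prod_of_dvd (s := range N) (fun _ => t)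
          (fun i => 1 - u (j + 1 + i)) (fun i _ => by
            rw [← hcu]; exact Dvd.dvd.mul_right (hc _) _)
        simpa using this
      rwa [hN, zero_dvd_iff] at this
    have hshift : (1 - u (j + 1)) * ∑ m ∈ range N, ∏ i ∈ range m, (1 - u (j + 2 + i))
        = ∑ m ∈ range N, ∏ i ∈ range m, (1 - u (j + 1 + i)) - 1 := by
      have h1 := sum_range_succ (fun m => ∏ i ∈ range m, (1 - u (j + 1 + i))) N
      rw [hprod, add_zero, sum_range_succ'] at h1
      rw [← h1, range_zero, prod_empty, add_sub_cancel_right, mul_sum]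
      refine sum_congr rfl fun m _ => ?_
      rw [prod_range_succ', add_zero, mul_comm]
      congr 1
      refine prod_congr rfl fun i _ => ?_
      congr 2
      ring
    simp only [Pi.sub_apply, transfer, Pi.one_apply, hψ]
    rw [show j + 1 + 1 = j + 2 from rfl, ← mul_assoc (c (j + 1)), hcu, hshift]
    linear_combination (∑ m ∈ range N, ∏ i ∈ range m, (1 - u (j + 1 + i))) * hu j
  have h := congrFun (sum_transfer_iterate_sub c ψ N) 0
  have hz : (transfer c)^[N] ψ 0 = 0 := by
    have := pow_dvd_transfer_iterate hc ψ N 0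
    rwa [hN, zero_dvd_iff] at this
  rw [hψ1, Pi.sub_apply, hz, sub_zero, Finset.sum_apply] at h
  rw [h, hψ]
  simp only [hu0, one_mul, zero_add, add_comm]

/-- The signed sum over sets `S` of columns allowed to be nonzero is an iterate of the transfer
operator. -/
theorem sum_powerset_eq_transfer_iterate {R : Type*} [CommRing R] (c φ : ℕ → R) (m : ℕ) :
    ∑ S ∈ (range m).powerset, (-1) ^ (m + #S) *
        (∏ r ∈ range m, c #{l ∈ S | l ≤ r}) * φ #S
      = (transfer c)^[m] φ 0 := by
  induction m generalizing φ with
  | zero => simp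
  | succ m ih =>
    rw [range_add_one, sum_powerset_insert notMem_range_self, Function.iterate_succ_apply, ← ih,
      ← sum_add_distrib]
    refine sum_congr rfl fun S hS => ?_
    have hm : m ∉ S := fun h => notMem_range_self (mem_powerset.1 hS h)
    have hlt : ∀ l ∈ S, l < m := fun l h => mem_range.1 (mem_powerset.1 hS h)
    rw [prod_insert notMem_range_self, prod_insert notMem_range_self, card_insert_of_notMem hm,
      filter_true_of_mem (fun l h => (hlt l h).le), filter_true_of_mem (s := insert m S)
        (fun l h => by
          rcases mem_insert.1 h with h | h
          exacts [h.le, (hlt l h).le]), card_insert_of_notMem hm]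
    have h : ∏ r ∈ range m, c #{l ∈ insert m S | l ≤ r} = ∏ r ∈ range m, c #{l ∈ S | l ≤ r} :=
      prod_congr rfl fun r hr => by
        rw [filter_insert, if_neg (by simpa using hr)]
    rw [h, transfer]
    ring


/-- The sum over all bounded functions of a product of local weights, avoiding the zero
function. -/
theorem sum_piFinset_ne_zero {R : Type*} [CommRing R] {m N : ℕ} (h : Fin m → ℕ → R)
    (h0 : ∀ l, h l 0 = 1) :
    ∑ v ∈ Fintype.piFinset fun _ : Fin m => range (N + 1), (if v ≠ 0 then 1 else 0) * ∏ l, h l (v l)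
      = ∏ l, ∑ a ∈ range (N + 1), h l a - 1 := by
  have hz : (0 : Fin m → ℕ) ∈ Fintype.piFinset fun _ : Fin m => range (N + 1) := by simp
  rw [prod_univ_sum, ← add_sum_erase _ _ hz, ← add_sum_erase _ (fun v => ∏ l, h l (v l)) hz]
  simp only [ne_eq, not_true_eq_false, if_false, zero_mul, zero_add, Pi.zero_apply, h0,
    prod_const_one, add_sub_cancel_left]
  refine sum_congr rfl fun v hv => ?_
  rw [if_pos (ne_of_mem_erase hv), one_mul]

/-- Square matrices with entries at most `N`. -/
abbrev box (m N : ℕ) : Finset (Fin m → Fin m → ℕ) :=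
  Fintype.piFinset fun _ => Fintype.piFinset fun _ => range (N + 1)

open Classical in
/-- Inclusion-exclusion over the set of vanishing columns for the weighted count of Fishburn
matrices with bounded entries. -/
theorem sum_isFishburn {R : Type*} [CommRing R] (m N : ℕ) (x : ℕ → R) :
    ∑ A ∈ (box m N) with IsFishburn A, ∏ i, ∏ j : Fin m, x j ^ A i j
      = ∑ S ∈ (range m).powerset, (-1) ^ (m + #S) * ∏ r ∈ range m,
          (∏ l ∈ S with l ≤ r, ∑ a ∈ range (N + 1), x l ^ a - 1) := by
  set e : (Fin m → Fin m → ℕ) → ℕ → R := fun A l =>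
    if ∀ i j : Fin m, (j : ℕ) = l → A i j = 0 then 1 else 0 with he
  set w : Finset ℕ → Fin m → Fin m → ℕ → R := fun S i j a =>
    if a = 0 ∨ j ≤ i ∧ (j : ℕ) ∈ S then x j ^ a else 0 with hw
  have hind : ∀ A : Fin m → Fin m → ℕ,
      (if IsFishburn A then ∏ i, ∏ j : Fin m, x j ^ A i j else 0)
        = ∑ S ∈ (range m).powerset, (-1) ^ (m + #S) *
            ∏ i, ((if A i ≠ 0 then 1 else 0) * ∏ j, w S i j (A i j)) := by
    intro A
    have hsign : ∀ S ∈ (range m).powerset, ((-1) ^ (m + #S) : R) = (-1) ^ #(range m \ S) := by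
      intro S hS
      have h := card_sdiff_add_card_eq_card (mem_powerset.1 hS)
      rw [card_range] at h
      conv_lhs => rw [← h, add_assoc, pow_add, Even.neg_one_pow ⟨_, rfl⟩, mul_one]
    by_cases htri : ∀ i j, i < j → A i j = 0
    · by_cases hrow : ∀ i, A i ≠ 0
      · have hterm : ∀ S ∈ (range m).powerset, (-1) ^ (m + #S) *
            ∏ i, ((if A i ≠ 0 then 1 else 0) * ∏ j, w S i j (A i j))
            = (∏ l ∈ S, 1) * (∏ l ∈ range m \ S, -e A l) * ∏ i, ∏ j : Fin m, x j ^ A i j := by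
          intro S hS
          rw [hsign S hS, prod_const_one, one_mul, prod_neg, mul_assoc]
          congr 1
          simp only [if_pos (hrow _), one_mul]
          by_cases hz : ∀ l ∈ range m \ S, ∀ i j : Fin m, (j : ℕ) = l → A i j = 0
          · rw [prod_congr rfl (fun l hl => if_pos (hz l hl)), prod_const_one, one_mul]
            refine prod_congr rfl fun i _ => prod_congr rfl fun j _ => if_pos ?_
            by_cases hj : (j : ℕ) ∈ S
            · by_cases hij : i < j
              · exact Or.inl (htri i j hij)
              · exact Or.inr ⟨not_lt.1 hij, hj⟩
            · exact Or.inl (hz j (mem_sdiff.2 ⟨mem_range.2 j.2, hj⟩) i j rfl)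
          · push Not at hz
            obtain ⟨l, hl, i, j, hjl, hA⟩ := hz
            rw [prod_eq_zero hl (if_neg fun h => hA (h i j hjl)), zero_mul]
            refine prod_eq_zero (mem_univ i) (prod_eq_zero (mem_univ j) (if_neg ?_))
            rintro (h | ⟨-, h⟩)
            · exact hA h
            · exact (mem_sdiff.1 hl).2 (hjl ▸ h)
        rw [sum_congr rfl hterm, ← sum_mul, ← prod_add]
        by_cases hcol : ∀ j, ∃ i, A i j ≠ 0
        · rw [if_pos ⟨htri, hrow, hcol⟩, prod_eq_one (s := range m), one_mul]
          intro l hl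
          obtain ⟨i, hi⟩ := hcol ⟨l, mem_range.1 hl⟩
          rw [he]
          dsimp only
          rw [if_neg fun h => hi (h i _ rfl), neg_zero, add_zero]
        · rw [if_neg fun h => hcol h.2.2]
          push Not at hcol
          obtain ⟨j, hj⟩ := hcol
          rw [prod_eq_zero (mem_range.2 j.2), zero_mul]
          rw [he]
          dsimp only
          rw [if_pos, add_neg_cancel]
          intro i j' h
          rw [Fin.ext h, hj]
      · rw [if_neg fun h => hrow h.2.1]
        push Not at hrow
        obtain ⟨i, hi⟩ := hrow
        refine (sum_eq_zero fun S _ => ?_).symm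
        rw [prod_eq_zero (mem_univ i), mul_zero]
        rw [if_neg (not_not.2 hi), zero_mul]
    · rw [if_neg fun h => htri h.1]
      push Not at htri
      obtain ⟨i, j, hij, hA⟩ := htri
      refine (sum_eq_zero fun S _ => ?_).symm
      rw [prod_eq_zero (mem_univ i), mul_zero]
      rw [prod_eq_zero (mem_univ j), mul_zero]
      refine if_neg ?_
      rintro (h | ⟨h, -⟩)
      exacts [hA h, hij.not_ge h]
  rw [sum_filter, sum_congr rfl (fun A _ => hind A), sum_comm]
  refine sum_congr rfl fun S hS => ?_
  rw [← mul_sum, ← prod_univ_sum (fun _ => Fintype.piFinset fun _ => range (N + 1))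
    (fun i v => (if v ≠ 0 then 1 else 0) * ∏ j, w S i j (v j)), prod_range]
  congr 1
  refine prod_congr rfl fun i _ => ?_
  rw [sum_piFinset_ne_zero _ (fun j => by simp [hw])]
  congr 1
  have hcell : ∀ j : Fin m, ∑ a ∈ range (N + 1), w S i j a
      = if (j : ℕ) ∈ S ∧ (j : ℕ) ≤ i then ∑ a ∈ range (N + 1), x j ^ a else 1 := by
    intro j
    split_ifs with h
    · exact sum_congr rfl fun a _ => if_pos (Or.inr ⟨h.2, h.1⟩)
    · rw [sum_eq_single 0]
      · simp [hw]
      · intro a _ ha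
        refine if_neg ?_
        rintro (h' | h')
        exacts [ha h', h ⟨h'.2, h'.1⟩]
      · simp
  rw [prod_congr rfl (fun j _ => hcell j),
    ← prod_range fun l => if l ∈ S ∧ l ≤ (i : ℕ) then ∑ a ∈ range (N + 1), x l ^ a else 1,
    ← prod_filter]
  refine prod_congr ?_ fun _ _ => rfl
  ext l
  have : l ∈ S → l ∈ range m := fun h => mem_powerset.1 hS h
  simp only [mem_filter]
  tauto


theorem prod_weight_pow {m : ℕ} (A : Fin m → Fin m → ℕ) :
    ∏ i, ∏ j : Fin m, (if (j : ℕ) = 0 then C X * X else X : ℤ[X][X]) ^ A i j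
      = C (X ^ firstColumnSum A) * X ^ ∑ i, ∑ j, A i j := by
  have h : ∀ i j : Fin m, (if (j : ℕ) = 0 then C X * X else X : ℤ[X][X]) ^ A i j
      = C X ^ (if (j : ℕ) = 0 then A i j else 0) * X ^ A i j := by
    intro i j
    split_ifs
    · rw [mul_pow]
    · rw [pow_zero, one_mul]
  simp_rw [h, prod_mul_distrib, prod_pow_eq_pow_sum, C_pow, firstColumnSum]

theorem mem_box_of_sum_eq {m n : ℕ} {A : Fin m → Fin m → ℕ} (h : ∑ i, ∑ j, A i j = n) :
    A ∈ box m n := by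
  simp only [Fintype.mem_piFinset, mem_range]
  intro i j
  have h1 := single_le_sum (f := fun i => ∑ j, A i j) (fun _ _ => Nat.zero_le _) (mem_univ i)
  have h2 := single_le_sum (f := A i) (fun _ _ => Nat.zero_le _) (mem_univ j)
  omega

open Classical in
theorem coeff_sum_isFishburn (m n k : ℕ) :
    ((∑ A ∈ (box m n) with IsFishburn A,
        ∏ i, ∏ j : Fin m, (if (j : ℕ) = 0 then C X * X else X : ℤ[X][X]) ^ A i j).coeff n).coeff k
      = #{A ∈ box m n | IsFishburn A ∧ ∑ i, ∑ j, A i j = n ∧ firstColumnSum A = k} := by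
  simp_rw [prod_weight_pow, finsetSum_coeff, coeff_C_mul_X_pow]
  rw [← filter_filter, card_filter, Nat.cast_sum]
  refine sum_congr rfl fun A _ => ?_
  by_cases h1 : ∑ i, ∑ j, A i j = n
  · simp [h1, coeff_X_pow, eq_comm]
  · simp [h1, Ne.symm h1]

open Classical in
/-- The weighted count of Fishburn matrices as a sum of products, in a ring where `t` is
nilpotent. -/
theorem sum_isFishburn_eq_sum_prod {R : Type*} [CommRing R] {n : ℕ} {t z : R}
    (ht : t ^ (n + 1) = 0) :
    ∑ m ∈ range (n + 1), ∑ A ∈ (box m n) with IsFishburn A,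
        ∏ i, ∏ j : Fin m, (if (j : ℕ) = 0 then z * t else t) ^ A i j
      = ∑ m ∈ range (n + 1), ∏ i ∈ range m, (1 - (1 - t) ^ i * (1 - z * t)) := by
  set g : R → R := fun x => ∑ a ∈ range (n + 1), x ^ a with hg
  have hgt : g t * (1 - t) = 1 := by rw [hg, geom_sum_mul_neg, ht, sub_zero]
  have hgz : g (z * t) * (1 - z * t) = 1 := by
    rw [hg, geom_sum_mul_neg, mul_pow, ht, mul_zero, sub_zero]
  let c : ℕ → R
    | 0 => 0
    | j + 1 => g (z * t) * g t ^ j - 1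
  let u : ℕ → R
    | 0 => 1
    | j + 1 => (1 - t) ^ j * (1 - z * t)
  have hu : ∀ j, u j * (1 + c j) = 1 := by
    rintro (_ | j)
    · simp [u, c]
    · calc u (j + 1) * (1 + c (j + 1))
          = (g (z * t) * (1 - z * t)) * (g t * (1 - t)) ^ j := by simp only [u, c]; rw [mul_pow]; ring
        _ = 1 := by rw [hgz, hgt, one_pow, one_mul]
  have hc : ∀ j, t ∣ c j := by
    have hdvd : ∀ j, t ∣ 1 - u j := by
      rintro (_ | j)
      · simp [u]
      · have h1 : t ∣ 1 - (1 - t) ^ j := by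
          simpa using sub_dvd_pow_sub_pow 1 (1 - t) j
        have h2 : 1 - u (j + 1) = (1 - (1 - t) ^ j) + t * ((1 - t) ^ j * z) := by
          simp only [u]; ring
        exact h2 ▸ dvd_add h1 (dvd_mul_right _ _)
    intro j
    have h : c j = (1 + c j) * (1 - u j) := by linear_combination hu j
    rw [h]
    exact (hdvd j).mul_left _
  have hprod : ∀ m, ∀ S ∈ (range m).powerset,
      ∏ r ∈ range m, (∏ l ∈ S with l ≤ r, g (if l = 0 then z * t else t) - 1)
        = ∏ r ∈ range m, c #{l ∈ S | l ≤ r} := by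
    intro m S hS
    by_cases h0 : 0 ∈ S
    · refine prod_congr rfl fun r _ => ?_
      have hmem : 0 ∈ {l ∈ S | l ≤ r} := mem_filter.2 ⟨h0, Nat.zero_le r⟩
      rw [← mul_prod_erase _ _ hmem, prod_congr rfl
        (fun l hl => by rw [if_neg (ne_of_mem_erase hl)]), prod_const,
        ← card_erase_add_one hmem, if_pos rfl]
    · rcases m.eq_zero_or_pos with rfl | hm
      · simp
      · have hempty : {l ∈ S | l ≤ 0} = ∅ := filter_eq_empty_iff.2 fun l hl h =>
          h0 (Nat.le_zero.1 h ▸ hl)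
        rw [prod_eq_zero (mem_range.2 hm), prod_eq_zero (mem_range.2 hm)]
        · rw [hempty]; rfl
        · rw [hempty, prod_empty, sub_self]
  rw [← sum_transfer_iterate_one ht hc hu rfl]
  refine sum_congr rfl fun m _ => ?_
  rw [sum_isFishburn m n fun l => if l = 0 then z * t else t, ← sum_powerset_eq_transfer_iterate]
  refine sum_congr rfl fun S hS => ?_
  rw [Pi.one_apply, mul_one, ← hprod m S hS]

open Classical in
/-- Modulo `t ^ (n + 1)`, the weighted count of Fishburn matrices is a sum of products. -/
theorem X_pow_dvd_sum_isFishburn_sub (n : ℕ) :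
    X ^ (n + 1) ∣ ∑ m ∈ range (n + 1), ∑ A ∈ (box m n) with IsFishburn A,
        ∏ i, ∏ j : Fin m, (if (j : ℕ) = 0 then C X * X else X : ℤ[X][X]) ^ A i j
      - ∑ m ∈ range (n + 1), ∏ i ∈ range m,
          ((1 : ℤ[X][X]) - (1 - X) ^ i * (1 - C X * X)) := by
  rw [← Ideal.mem_span_singleton, ← Ideal.Quotient.eq]
  have hX : Ideal.Quotient.mk (Ideal.span {(X : ℤ[X][X]) ^ (n + 1)}) X ^ (n + 1) = 0 := by
    rw [← map_pow]
    exact Ideal.Quotient.eq_zero_iff_mem.2 (Ideal.mem_span_singleton_self _)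
  have h := sum_isFishburn_eq_sum_prod
    (z := Ideal.Quotient.mk (Ideal.span {(X : ℤ[X][X]) ^ (n + 1)}) (C X)) hX
  simpa only [map_sum, map_prod, map_pow, map_sub, map_mul, map_one, apply_ite] using h

end Fishburn

/-- For every positive integer `n` and every `k ≥ 0`, the number of
isomorphism classes of `(2+2)`-free partial orders on `n` elements with exactly `k`
minimal elements equals the coefficient of `z^k t^n` in the polynomial
`Σ_{m=0}^{n} ∏_{i=1}^{m} (1 − (1−t)^{i−1}(1−zt))`.  Isomorphism classes are rendered as
elements of the quotient of `PartialOrder (Fin n)` by the isomorphism relation; on the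
right the outer variable `X : Polynomial (Polynomial ℤ)` plays the role of `t` and `C X`
the role of `z`, the product index `i ∈ Finset.range m` corresponding to the paper's
`i+1`. -/
theorem card_twoTwoFree_posets_eq_coeff (n k : ℕ) (hn : 0 < n) :
    ((Quot.mk (OrderIsoRel n) ''
        {P : PartialOrder (Fin n) | TwoTwoFree n P ∧ minCount n P = k}).ncard : ℤ)
    = ((∑ m ∈ Finset.range (n + 1), ∏ i ∈ Finset.range m,
          ((1 : Polynomial (Polynomial ℤ))
            - (1 - X) ^ i * (1 - C X * X))).coeff n).coeff k := by
  classical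
  have h := X_pow_dvd_iff.1 (Fishburn.X_pow_dvd_sum_isFishburn_sub n) n n.lt_succ_self
  rw [coeff_sub, sub_eq_zero] at h
  rw [← h, finsetSum_coeff, finsetSum_coeff]
  simp_rw [Fishburn.coeff_sum_isFishburn]
  rw [Fishburn.ncard_isoClasses n k _ fun m A => ?_, Nat.cast_sum]
  rw [Finset.mem_filter]
  exact ⟨fun h => h.2, fun h => ⟨Fishburn.mem_box_of_sum_eq h.2.1, h⟩⟩
end

section
/- Let A be an improper matrix in M_n whose largest improper column index is i and suppose csum_i(A) ≥ 2. Let Φ(A) be the matrix obtained from A by setting the entry in row min_i(A) of column i to 0, inserting a new all-zero row between rows i and i+1, and inserting a new column between columns i and i+1 that is all zeros except for a 1 in row min_i(A). Then Φ(A) is an improper matrix in M_n, its largest improper column index is i+1, dim(Φ(A)) = dim(A) + 1, and rsum_1(Φ(A)) = rsum_1(A). -/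
open Polynomial

/-- A finite square matrix of natural numbers, of arbitrary dimension. -/
def SqMat : Type := Σ d : ℕ, Matrix (Fin d) (Fin d) ℕ

namespace SqMat

/-- The number of rows (= number of columns) of the matrix. -/
def dim (A : SqMat) : ℕ := A.1

/-- The entry in row `r`, column `c` (0-indexed), and `0` out of range. -/
def ent (A : SqMat) (r c : ℕ) : ℕ :=
  if h : r < A.1 ∧ c < A.1 then A.2 ⟨r, h.1⟩ ⟨c, h.2⟩ else 0

/-- The sum of the entries of row `i` (0-indexed). -/
def rsum (A : SqMat) (i : ℕ) : ℕ := ∑ j ∈ Finset.range A.1, A.ent i j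

/-- The sum of the entries of column `j` (0-indexed). -/
def csum (A : SqMat) (j : ℕ) : ℕ := ∑ i ∈ Finset.range A.1, A.ent i j

/-- The sum of all entries of the matrix. -/
def total (A : SqMat) : ℕ := ∑ i ∈ Finset.range A.1, A.rsum i

/-- The least row index (0-indexed) at which column `j` has a nonzero entry. -/
noncomputable def colMin (A : SqMat) (j : ℕ) : ℕ := sInf {i : ℕ | A.ent i j ≠ 0}

/-- The matrix is upper triangular. -/
def UpperTri (A : SqMat) : Prop := ∀ r c : ℕ, c < r → A.ent r c = 0

/-- All entries are `0` or `1`. -/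
def ZeroOne (A : SqMat) : Prop := ∀ r c : ℕ, A.ent r c ≤ 1

/-- Every column contains at least one nonzero entry. -/
def ColsNonzero (A : SqMat) : Prop := ∀ j < A.1, 0 < A.csum j

/-- Every row contains at least one nonzero entry. -/
def RowsNonzero (A : SqMat) : Prop := ∀ i < A.1, 0 < A.rsum i

/-- Membership in `M_n`: upper triangular `(0,1)`-matrices with entries summing
to `n` in which every column contains at least one nonzero entry. -/
def MemM (n : ℕ) (A : SqMat) : Prop :=
  A.UpperTri ∧ A.ZeroOne ∧ A.total = n ∧ A.ColsNonzero

/-- Column `j` (0-indexed; so `j` corresponds to the 1-indexed column `j+1` of the paper)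
is improper: either its column sum is at least `2`, or `j ≥ 1`, its column sum is `1`,
its row sum is `0`, and `min_j(A) < min_{j-1}(A)`. -/
def ImproperCol (A : SqMat) (j : ℕ) : Prop :=
  2 ≤ A.csum j ∨
    (1 ≤ j ∧ A.csum j = 1 ∧ A.rsum j = 0 ∧ A.colMin j < A.colMin (j - 1))

/-- The matrix is proper: no column is improper. -/
def Proper (A : SqMat) : Prop := ∀ j < A.1, ¬ A.ImproperCol j

/-- Membership in `PM_n`: proper matrices of `M_n`. -/
def MemPM (n : ℕ) (A : SqMat) : Prop := MemM n A ∧ A.Proper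

/-- Membership in `I_n`: upper triangular matrices with non-negative integer entries
summing to `n` in which every row and every column contains at least one nonzero entry. -/
def MemI (n : ℕ) (A : SqMat) : Prop :=
  A.UpperTri ∧ A.total = n ∧ A.RowsNonzero ∧ A.ColsNonzero

end SqMat

namespace SqMat

/-- The matrix obtained from `A` (for Case (1) of the involution, at 0-indexed column `i`):
replace the entry in row `colMin A i` of column `i` by `0`, insert a new all-zero row
between rows `i` and `i+1`, and insert a new column between columns `i` and `i+1` that is
all zeros except for a `1` in row `colMin A i`. -/
noncomputable def insertPhi (A : SqMat) (i : ℕ) : SqMat :=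
  ⟨A.1 + 1, Matrix.of fun r c : Fin (A.1 + 1) =>
    if (r : ℕ) = i + 1 then 0
    else if (c : ℕ) = i + 1 then (if (r : ℕ) = A.colMin i then 1 else 0)
    else
      (fun r' c' => if r' = A.colMin i ∧ c' = i then 0 else A.ent r' c')
        (if (r : ℕ) ≤ i then (r : ℕ) else (r : ℕ) - 1)
        (if (c : ℕ) ≤ i then (c : ℕ) else (c : ℕ) - 1)⟩

end SqMat

namespace SqMat

/-- The order embedding of `ℕ` into itself whose range misses exactly `i + 1`. -/
def skipSucc (i r : ℕ) : ℕ := if r ≤ i then r else r + 1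

lemma skipSucc_of_le {i r : ℕ} (h : r ≤ i) : skipSucc i r = r := if_pos h

lemma skipSucc_of_lt {i r : ℕ} (h : i < r) : skipSucc i r = r + 1 := if_neg h.not_ge

lemma skipSucc_ne (i r : ℕ) : skipSucc i r ≠ i + 1 := by
  unfold skipSucc; split_ifs <;> omega

lemma skipSucc_strictMono (i : ℕ) : StrictMono (skipSucc i) := by
  intro a b hab
  unfold skipSucc; split_ifs <;> omega

lemma exists_skipSucc_eq {i r : ℕ} (h : r ≠ i + 1) : ∃ r', skipSucc i r' = r := by
  rcases Nat.lt_or_ge i r with hr | hr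
  · exact ⟨r - 1, by rw [skipSucc_of_lt (by omega)]; omega⟩
  · exact ⟨r, skipSucc_of_le hr⟩

lemma skipSucc_lt_succ_iff {i d r : ℕ} (hi : i < d) : skipSucc i r < d + 1 ↔ r < d := by
  unfold skipSucc; split_ifs <;> omega

lemma sum_range_succ_skipSucc {i d : ℕ} (hi : i < d) (f : ℕ → ℕ) :
    ∑ r ∈ Finset.range (d + 1), f r = f (i + 1) + ∑ r ∈ Finset.range d, f (skipSucc i r) := by
  induction d, hi using Nat.le_induction with
  | base =>
    rw [Finset.sum_range_succ, add_comm]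
    congr 1
    refine Finset.sum_congr rfl fun r hr => ?_
    rw [skipSucc_of_le (by simpa [Nat.lt_succ_iff] using hr)]
  | succ d hd ih =>
    rw [Finset.sum_range_succ, ih, Finset.sum_range_succ _ d, skipSucc_of_lt (by omega), add_assoc]

lemma ent_colMin_ne_zero {A : SqMat} {j : ℕ} (h : 0 < A.csum j) : A.ent (A.colMin j) j ≠ 0 := by
  obtain ⟨r, -, hr⟩ := Finset.exists_ne_zero_of_sum_ne_zero h.ne'
  exact Nat.sInf_mem (s := {i : ℕ | A.ent i j ≠ 0}) ⟨r, hr⟩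

lemma colMin_le {A : SqMat} {r j : ℕ} (h : A.ent r j ≠ 0) : A.colMin j ≤ r :=
  Nat.sInf_le h

lemma insertPhi_ent_row (A : SqMat) (i c : ℕ) : (A.insertPhi i).ent (i + 1) c = 0 := by
  simp [ent, insertPhi]

section

variable {A : SqMat} {i : ℕ}

lemma insertPhi_ent_col (hi : i < A.1) (hm : A.colMin i ≤ i) (r : ℕ) :
    (A.insertPhi i).ent r (i + 1) = if r = A.colMin i then 1 else 0 := by
  by_cases hr : r < A.1 + 1
  · simp only [ent, insertPhi, Matrix.of_apply]
    rw [dif_pos ⟨hr, by omega⟩]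
    split_ifs <;> first | rfl | omega
  · rw [if_neg (by omega)]
    exact dif_neg fun h => hr h.1

lemma insertPhi_ent_skipSucc (hi : i < A.1) (r c : ℕ) :
    (A.insertPhi i).ent (skipSucc i r) (skipSucc i c) =
      if r = A.colMin i ∧ c = i then 0 else A.ent r c := by
  have key (x : ℕ) : (if skipSucc i x ≤ i then skipSucc i x else skipSucc i x - 1) = x := by
    unfold skipSucc; split_ifs <;> omega
  by_cases h : r < A.1 ∧ c < A.1
  · have h' : skipSucc i r < A.1 + 1 ∧ skipSucc i c < A.1 + 1 :=
      ⟨(skipSucc_lt_succ_iff hi).2 h.1, (skipSucc_lt_succ_iff hi).2 h.2⟩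
    rw [ent, dif_pos (by exact h')]
    simp only [insertPhi, Matrix.of_apply, if_neg (skipSucc_ne i _), key]
  · have hz : A.ent r c = 0 := dif_neg h
    rw [hz, ite_self]
    refine dif_neg fun h' => h ?_
    exact ⟨(skipSucc_lt_succ_iff hi).1 h'.1, (skipSucc_lt_succ_iff hi).1 h'.2⟩

lemma insertPhi_ent_skipSucc_of_ne (hi : i < A.1) {c : ℕ} (hc : c ≠ i) (r : ℕ) :
    (A.insertPhi i).ent (skipSucc i r) (skipSucc i c) = A.ent r c := by
  rw [insertPhi_ent_skipSucc hi, if_neg fun h => hc h.2]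

lemma insertPhi_rsum_succ : (A.insertPhi i).rsum (i + 1) = 0 :=
  Finset.sum_eq_zero fun c _ => insertPhi_ent_row A i c

lemma insertPhi_rsum_skipSucc (hi : i < A.1) (hm : A.colMin i ≤ i)
    (h1 : A.ent (A.colMin i) i = 1) (r : ℕ) :
    (A.insertPhi i).rsum (skipSucc i r) = A.rsum r := by
  have hsplit (c : ℕ) : A.ent r c = (if c = i then (if r = A.colMin i then 1 else 0) else 0) +
      (A.insertPhi i).ent (skipSucc i r) (skipSucc i c) := by
    rw [insertPhi_ent_skipSucc hi]
    by_cases hc : c = i <;> by_cases hr : r = A.colMin i <;> simp [hc, hr, h1]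
  have hiff : skipSucc i r = A.colMin i ↔ r = A.colMin i := by
    unfold skipSucc; split_ifs <;> omega
  have hL : (A.insertPhi i).rsum (skipSucc i r) = _ :=
    sum_range_succ_skipSucc hi fun c => (A.insertPhi i).ent (skipSucc i r) c
  rw [hL, insertPhi_ent_col hi hm, rsum, Finset.sum_congr rfl fun c _ => hsplit c,
    Finset.sum_add_distrib, Finset.sum_ite_eq', if_pos (Finset.mem_range.2 hi)]
  simp only [hiff]

lemma insertPhi_csum_skipSucc (hi : i < A.1) (c : ℕ) :
    (A.insertPhi i).csum (skipSucc i c) =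
      ∑ r ∈ Finset.range A.1, (A.insertPhi i).ent (skipSucc i r) (skipSucc i c) := by
  have hL : (A.insertPhi i).csum (skipSucc i c) = _ :=
    sum_range_succ_skipSucc hi fun r => (A.insertPhi i).ent r (skipSucc i c)
  rw [hL, insertPhi_ent_row, zero_add]

lemma insertPhi_csum_skipSucc_of_ne (hi : i < A.1) {c : ℕ} (hc : c ≠ i) :
    (A.insertPhi i).csum (skipSucc i c) = A.csum c := by
  rw [insertPhi_csum_skipSucc hi]
  exact Finset.sum_congr rfl fun r _ => insertPhi_ent_skipSucc_of_ne hi hc r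

lemma insertPhi_csum_self (hi : i < A.1) (hm : A.colMin i ≤ i)
    (h1 : A.ent (A.colMin i) i = 1) : (A.insertPhi i).csum i + 1 = A.csum i := by
  have hsplit (r : ℕ) : A.ent r i = (A.insertPhi i).ent (skipSucc i r) (skipSucc i i) +
      (if r = A.colMin i then 1 else 0) := by
    rw [insertPhi_ent_skipSucc hi]
    by_cases hr : r = A.colMin i <;> simp [hr, h1]
  have hL := insertPhi_csum_skipSucc hi i
  rw [skipSucc_of_le le_rfl] at hL
  rw [csum.eq_def A, Finset.sum_congr rfl fun r _ => hsplit r, Finset.sum_add_distrib,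
    Finset.sum_ite_eq', if_pos (Finset.mem_range.2 (by omega)), hL, skipSucc_of_le le_rfl]

lemma insertPhi_csum_succ (hi : i < A.1) (hm : A.colMin i ≤ i) :
    (A.insertPhi i).csum (i + 1) = 1 := by
  change ∑ r ∈ Finset.range (A.1 + 1), (A.insertPhi i).ent r (i + 1) = 1
  rw [Finset.sum_congr rfl fun r _ => insertPhi_ent_col hi hm r, Finset.sum_ite_eq',
    if_pos (Finset.mem_range.2 (by omega))]

lemma insertPhi_colMin_succ (hi : i < A.1) (hm : A.colMin i ≤ i) :
    (A.insertPhi i).colMin (i + 1) = A.colMin i := by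
  have h := ent_colMin_ne_zero (A := A.insertPhi i) (j := i + 1)
    (by rw [insertPhi_csum_succ hi hm]; exact one_pos)
  rw [insertPhi_ent_col hi hm] at h
  by_contra hne
  exact h (if_neg hne)

lemma insertPhi_colMin_skipSucc (hi : i < A.1) {c : ℕ} (hc : c ≠ i) (hpos : 0 < A.csum c) :
    (A.insertPhi i).colMin (skipSucc i c) = skipSucc i (A.colMin c) := by
  apply le_antisymm
  · apply colMin_le
    rw [insertPhi_ent_skipSucc_of_ne hi hc]
    exact ent_colMin_ne_zero hpos
  · have h := ent_colMin_ne_zero (A := A.insertPhi i) (j := skipSucc i c)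
      (by rwa [insertPhi_csum_skipSucc_of_ne hi hc])
    have hne : (A.insertPhi i).colMin (skipSucc i c) ≠ i + 1 := fun he =>
      h (by rw [he]; exact insertPhi_ent_row A i _)
    obtain ⟨r, hr⟩ := exists_skipSucc_eq hne
    rw [← hr, insertPhi_ent_skipSucc_of_ne hi hc] at h
    rw [← hr]
    exact (skipSucc_strictMono i).monotone (colMin_le h)

lemma colMin_lt_insertPhi_colMin_self (hi : i < A.1) (hpos : 0 < (A.insertPhi i).csum i) :
    A.colMin i < (A.insertPhi i).colMin i := by
  have h := ent_colMin_ne_zero hpos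
  have hne : (A.insertPhi i).colMin i ≠ i + 1 := fun he =>
    h (by rw [he]; exact insertPhi_ent_row A i _)
  obtain ⟨r, hr⟩ := exists_skipSucc_eq hne
  rw [← hr, ← congrArg ((A.insertPhi i).ent (skipSucc i r)) (skipSucc_of_le (le_refl i)),
    insertPhi_ent_skipSucc hi] at h
  have hrm : r ≠ A.colMin i := fun he => h (if_pos ⟨he, rfl⟩)
  rw [if_neg fun h' => hrm h'.1] at h
  have hlt := lt_of_le_of_ne (colMin_le h) hrm.symm
  have hle : r ≤ skipSucc i r := (skipSucc_strictMono i).le_apply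
  omega

lemma insertPhi_upperTri (hA : A.UpperTri) (hi : i < A.1) (hm : A.colMin i ≤ i) :
    (A.insertPhi i).UpperTri := by
  intro r c hcr
  by_cases hr : r = i + 1
  · rw [hr, insertPhi_ent_row]
  by_cases hc : c = i + 1
  · rw [hc, insertPhi_ent_col hi hm, if_neg (by omega)]
  obtain ⟨r, rfl⟩ := exists_skipSucc_eq hr
  obtain ⟨c, rfl⟩ := exists_skipSucc_eq hc
  rw [insertPhi_ent_skipSucc hi, hA r c ((skipSucc_strictMono i).lt_iff_lt.1 hcr), ite_self]

lemma insertPhi_zeroOne (hA : A.ZeroOne) (hi : i < A.1) (hm : A.colMin i ≤ i) :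
    (A.insertPhi i).ZeroOne := by
  intro r c
  by_cases hr : r = i + 1
  · rw [hr, insertPhi_ent_row]; exact zero_le_one
  by_cases hc : c = i + 1
  · rw [hc, insertPhi_ent_col hi hm]; split_ifs <;> simp
  obtain ⟨r, rfl⟩ := exists_skipSucc_eq hr
  obtain ⟨c, rfl⟩ := exists_skipSucc_eq hc
  rw [insertPhi_ent_skipSucc hi]
  split_ifs
  · exact zero_le_one
  · exact hA r c

lemma insertPhi_total (hi : i < A.1) (hm : A.colMin i ≤ i) (h1 : A.ent (A.colMin i) i = 1) :
    (A.insertPhi i).total = A.total := by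
  have hL : (A.insertPhi i).total = _ := sum_range_succ_skipSucc hi (A.insertPhi i).rsum
  rw [hL, insertPhi_rsum_succ, zero_add]
  exact Finset.sum_congr rfl fun r _ => insertPhi_rsum_skipSucc hi hm h1 r

lemma insertPhi_colsNonzero (hA : A.ColsNonzero) (hi : i < A.1) (hm : A.colMin i ≤ i)
    (hpos : 0 < (A.insertPhi i).csum i) : (A.insertPhi i).ColsNonzero := by
  intro j hj
  by_cases hji : j = i + 1
  · rw [hji, insertPhi_csum_succ hi hm]; exact one_pos
  obtain ⟨c, rfl⟩ := exists_skipSucc_eq hji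
  by_cases hc : c = i
  · rwa [hc, skipSucc_of_le le_rfl]
  · rw [insertPhi_csum_skipSucc_of_ne hi hc]
    exact hA c ((skipSucc_lt_succ_iff hi).1 hj)

lemma improperCol_of_insertPhi (hA : A.ColsNonzero) (hi : i < A.1) (hm : A.colMin i ≤ i)
    (h1 : A.ent (A.colMin i) i = 1) {c : ℕ} (hic : i < c) (hc : c < A.1)
    (h : (A.insertPhi i).ImproperCol (c + 1)) : A.ImproperCol c := by
  have hs : skipSucc i c = c + 1 := skipSucc_of_lt hic
  have hprev : (A.insertPhi i).colMin c = skipSucc i (A.colMin (c - 1)) := by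
    by_cases hci : c = i + 1
    · rw [hci, insertPhi_colMin_succ hi hm, Nat.add_sub_cancel, skipSucc_of_le hm]
    · have h' := insertPhi_colMin_skipSucc hi (c := c - 1) (by omega) (hA _ (by omega))
      rwa [skipSucc_of_lt (r := c - 1) (by omega), Nat.sub_add_cancel (by omega)] at h'
  rw [ImproperCol, Nat.add_sub_cancel, hprev, ← hs, insertPhi_csum_skipSucc_of_ne hi hic.ne',
    insertPhi_rsum_skipSucc hi hm h1, insertPhi_colMin_skipSucc hi hic.ne' (hA c hc),
    (skipSucc_strictMono i).lt_iff_lt] at h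
  exact h.imp_right fun h => ⟨by omega, h.2⟩

end

end SqMat

/-- Let `A ∈ M_n` be improper with largest improper column index `i`
(0-indexed; the paper's 1-indexed column is `i+1`) and suppose `csum_i(A) ≥ 2`.  Then the
matrix `Φ(A) = insertPhi A i` is an improper matrix in `M_n`, its largest improper column
index is `i+1`, `dim (Φ A) = dim A + 1`, and the first-row sums of `Φ(A)` and `A` agree. -/
theorem insertPhi_spec (n : ℕ) (hn : 0 < n) (A : SqMat) (hA : SqMat.MemM n A)
    (i : ℕ) (hi : i < A.dim) (himp : A.ImproperCol i)
    (hmax : ∀ j : ℕ, i < j → j < A.dim → ¬ A.ImproperCol j)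
    (hcs : 2 ≤ A.csum i) :
    SqMat.MemM n (A.insertPhi i) ∧
    (∃ j < (A.insertPhi i).dim, (A.insertPhi i).ImproperCol j) ∧
    (A.insertPhi i).ImproperCol (i + 1) ∧
    (∀ j : ℕ, i + 1 < j → j < (A.insertPhi i).dim → ¬ (A.insertPhi i).ImproperCol j) ∧
    (A.insertPhi i).dim = A.dim + 1 ∧
    (A.insertPhi i).rsum 0 = A.rsum 0 := by
  change i < A.1 at hi
  obtain ⟨hU, hZ, hT, hC⟩ := hA
  have hne : A.ent (A.colMin i) i ≠ 0 := SqMat.ent_colMin_ne_zero (by omega)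
  have h1 : A.ent (A.colMin i) i = 1 := by
    have := hZ (A.colMin i) i
    omega
  have hm : A.colMin i ≤ i := by
    by_contra h
    exact hne (hU _ _ (by omega))
  have hpos : 0 < (A.insertPhi i).csum i := by
    have := SqMat.insertPhi_csum_self hi hm h1
    omega
  have himp' : (A.insertPhi i).ImproperCol (i + 1) := by
    refine Or.inr ⟨by omega, SqMat.insertPhi_csum_succ hi hm, SqMat.insertPhi_rsum_succ, ?_⟩
    rw [SqMat.insertPhi_colMin_succ hi hm, Nat.add_sub_cancel]
    exact SqMat.colMin_lt_insertPhi_colMin_self hi hpos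
  refine ⟨⟨SqMat.insertPhi_upperTri hU hi hm, SqMat.insertPhi_zeroOne hZ hi hm,
      (SqMat.insertPhi_total hi hm h1).trans hT, SqMat.insertPhi_colsNonzero hC hi hm hpos⟩,
    ⟨i + 1, Nat.succ_lt_succ hi, himp'⟩, himp', ?_, rfl, ?_⟩
  · intro j hj hjd hbad
    obtain ⟨c, rfl⟩ : ∃ c, j = c + 1 := ⟨j - 1, by omega⟩
    have hc : c < A.1 := Nat.lt_of_succ_lt_succ hjd
    exact hmax c (by omega) hc (SqMat.improperCol_of_insertPhi hC hi hm h1 (by omega) hc hbad)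
  · have h := SqMat.insertPhi_rsum_skipSucc hi hm h1 0
    rwa [SqMat.skipSucc_of_le (Nat.zero_le i)] at h
end
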